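/- arXiv:2407.03287 — 2 statements merged into one kernel-verified Lean document; each statement's English description precedes it below -/
import Mathlib

section
/- For every natural number n, the number of dispersed Dyck paths of length n equals the number of sequences (s(1), …, s(n)) with each s(i) ∈ {−1, +1} whose total sum s(1) + ⋯ + s(n) equals 0 if n is even and −1 if n is odd. -/
/-- Step sequences of dispersed Dyck paths that start at height `h` and end at height `0`. -/
def IsDispersedDyckFrom {n : ℕ} (h : ℤ) (s : Fin n → ℤ) : Prop :=
  (∀ i, s i = -1 ∨ s i = 0 ∨ s i = 1) ∧
  (∀ j : Fin n, 0 ≤ h + ∑ i ∈ Finset.univ.filter (fun i => i ≤ j), s i) ∧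
  (h + ∑ i, s i = 0) ∧
  (∀ i : Fin n, s i = 0 → h + ∑ j ∈ Finset.univ.filter (fun j => j < i), s j = 0)

/-- Step sequences of `±1`-paths that start at height `y` and end at height `0` or `-1`. -/
def IsSignPathFrom {n : ℕ} (y : ℤ) (s : Fin n → ℤ) : Prop :=
  (∀ i, s i = -1 ∨ s i = 1) ∧ (y + ∑ i, s i = 0 ∨ y + ∑ i, s i = -1)

/-- The reflection of the negative heights about `-1/2`. -/
def foldHeight (y : ℤ) : ℤ := if 0 ≤ y then y else -1 - y

/-- A step that a dispersed Dyck path may take at height `h`. -/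
def IsDispersedStep (h a : ℤ) : Prop :=
  (a = -1 ∨ a = 0 ∨ a = 1) ∧ 0 ≤ h + a ∧ (a = 0 → h = 0)

theorem isDispersedDyckFrom_cons {n : ℕ} (h a : ℤ) (t : Fin n → ℤ) :
    IsDispersedDyckFrom h (Fin.cons a t : Fin (n + 1) → ℤ) ↔
      IsDispersedStep h a ∧ IsDispersedDyckFrom (h + a) t := by
  simp only [IsDispersedDyckFrom, IsDispersedStep, Fin.forall_fin_succ, Finset.sum_filter,
    Fin.sum_univ_succ, Fin.cons_zero, Fin.cons_succ, Fin.succ_le_succ_iff, Fin.succ_lt_succ_iff,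
    Fin.zero_le, Fin.succ_pos, Fin.not_lt_zero, Fin.le_zero_iff, Fin.succ_ne_zero, if_true,
    if_false, Finset.sum_const_zero, add_zero, add_assoc]
  tauto

theorem isSignPathFrom_cons {n : ℕ} (y a : ℤ) (t : Fin n → ℤ) :
    IsSignPathFrom y (Fin.cons a t : Fin (n + 1) → ℤ) ↔
      (a = -1 ∨ a = 1) ∧ IsSignPathFrom (y + a) t := by
  simp only [IsSignPathFrom, Fin.forall_fin_succ, Fin.sum_univ_succ, Fin.cons_zero,
    Fin.cons_succ, add_assoc, and_assoc]

/-- Splitting off the first entry of a tuple, for a predicate that factors accordingly. -/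
def subtypeConsEquivSigma {n : ℕ} {α : Type*} {S : (Fin (n + 1) → α) → Prop} {R : α → Prop}
    {T : α → (Fin n → α) → Prop}
    (hS : ∀ a t, S (Fin.cons a t : Fin (n + 1) → α) ↔ R a ∧ T a t) :
    {s // S s} ≃ Σ a : {a // R a}, {t // T a t} where
  toFun s :=
    have h := (hS (s.1 0) (Fin.tail s.1)).1 (by rw [Fin.cons_self_tail]; exact s.2)
    ⟨⟨s.1 0, h.1⟩, ⟨Fin.tail s.1, h.2⟩⟩
  invFun p := ⟨Fin.cons p.1.1 p.2.1, (hS _ _).2 ⟨p.1.2, p.2.2⟩⟩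
  left_inv s := Subtype.ext (Fin.cons_self_tail s.1)
  right_inv _ := rfl

theorem isDispersedStep_foldHeight {y a : ℤ} (ha : a = -1 ∨ a = 1) :
    IsDispersedStep (foldHeight y) (foldHeight (y + a) - foldHeight y) := by
  unfold IsDispersedStep foldHeight
  split_ifs <;> omega

theorem bijective_foldHeight_step (y : ℤ) :
    Function.Bijective (fun a : {a : ℤ // a = -1 ∨ a = 1} =>
      (⟨foldHeight (y + a) - foldHeight y, isDispersedStep_foldHeight a.2⟩ :
        {b // IsDispersedStep (foldHeight y) b})) := by
  constructor
  · rintro ⟨a, ha⟩ ⟨b, hb⟩ hab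
    simp only [Subtype.mk.injEq, foldHeight] at hab ⊢
    split_ifs at hab <;> omega
  · rintro ⟨b, hb⟩
    simp only [Subtype.exists, Subtype.mk.injEq]
    have key : foldHeight (y + 1) - foldHeight y = b ∨ foldHeight (y + -1) - foldHeight y = b := by
      unfold IsDispersedStep at hb
      unfold foldHeight at *
      split_ifs at * <;> omega
    rcases key with h | h
    · exact ⟨1, Or.inr rfl, h⟩
    · exact ⟨-1, Or.inl rfl, h⟩

theorem nonempty_signPath_equiv_dispersedDyck (n : ℕ) (y : ℤ) :
    Nonempty ({s : Fin n → ℤ // IsSignPathFrom y s} ≃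
      {s : Fin n → ℤ // IsDispersedDyckFrom (foldHeight y) s}) := by
  induction n generalizing y with
  | zero =>
    refine ⟨Equiv.subtypeEquivRight fun s => ?_⟩
    simp only [IsSignPathFrom, IsDispersedDyckFrom, foldHeight, IsEmpty.forall_iff,
      Finset.univ_eq_empty, Finset.sum_empty, add_zero, true_and, and_true]
    split_ifs <;> omega
  | succ n ih =>
    refine ⟨(subtypeConsEquivSigma (isSignPathFrom_cons y)).trans <| Equiv.trans
      (Equiv.sigmaCongr (Equiv.ofBijective _ (bijective_foldHeight_step y)) fun a => ?_)
      (subtypeConsEquivSigma (isDispersedDyckFrom_cons (foldHeight y))).symm⟩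
    refine (ih (y + a)).some.trans (Equiv.subtypeEquivRight fun s => ?_)
    simp only [Equiv.ofBijective_apply, add_sub_cancel]

theorem even_sum_sub_card_of_sign {n : ℕ} {s : Fin n → ℤ} (hs : ∀ i, s i = -1 ∨ s i = 1) :
    Even (∑ i, s i - n) := by
  have h : ∑ i, s i - n = ∑ i, (s i - 1) := by simp
  rw [h]
  refine Finset.even_sum _ fun i _ => ?_
  rcases hs i with h | h <;> rw [h] <;> decide

theorem isSignPathFrom_zero_iff {n : ℕ} (s : Fin n → ℤ) :
    IsSignPathFrom 0 s ↔
      (∀ i, s i = -1 ∨ s i = 1) ∧ (∑ i, s i = if Even n then 0 else -1) := by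
  refine and_congr_right fun hs => ?_
  have h := even_sum_sub_card_of_sign hs
  rw [Int.even_iff] at h
  rw [zero_add]
  split_ifs with hn <;> rw [Nat.even_iff] at hn <;> omega

/-- The number of dispersed Dyck paths of length `n` equals the number of `±1`-sequences
of length `n` with total sum `0` if `n` is even and `-1` if `n` is odd. -/
theorem card_dispersedDyckPaths_eq_card_pm_sequences (n : ℕ) :
    Nat.card {s : Fin n → ℤ //
      (∀ i, s i = -1 ∨ s i = 0 ∨ s i = 1) ∧
      (∀ j : Fin n, 0 ≤ ∑ i ∈ Finset.univ.filter (fun i => i ≤ j), s i) ∧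
      (∑ i, s i = 0) ∧
      (∀ i : Fin n, s i = 0 → ∑ j ∈ Finset.univ.filter (fun j => j < i), s j = 0)} =
    Nat.card {s : Fin n → ℤ //
      (∀ i, s i = -1 ∨ s i = 1) ∧
      (∑ i, s i = if Even n then 0 else -1)} := by
  obtain ⟨e⟩ := nonempty_signPath_equiv_dispersedDyck n 0
  refine Nat.card_congr (Equiv.trans (Equiv.subtypeEquivRight fun s => ?_)
    (e.symm.trans (Equiv.subtypeEquivRight isSignPathFrom_zero_iff)))
  simp only [IsDispersedDyckFrom, foldHeight, le_refl, if_true, zero_add]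
end

section
/- For every odd natural number k ≥ 1, the sum over even m with 2 ≤ m ≤ k+1 of the sums, over all m-tuples (n₁, …, n_m) of natural numbers with n₁ + ⋯ + n_m = (k−m+1)/2, of the products C(n₁)⋯C(n_m), plus the Catalan number C((k−1)/2), equals 2·C(k−1, (k−1)/2) (twice the binomial coefficient k−1 choose (k−1)/2). -/
open PowerSeries in
/-- The coefficients of the `m`-th power of a power series, as sums over `m`-tuples. -/
theorem PowerSeries.coeff_pow_eq_sum_antidiagonalTuple {R : Type*} [CommSemiring R]
    (f : R⟦X⟧) (m n : ℕ) :
    coeff n (f ^ m) = ∑ t ∈ Finset.Nat.antidiagonalTuple m n, ∏ i, coeff (t i) f := by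
  have h : f ^ m = ∏ _i : Fin m, f := by simp
  rw [h, coeff_prod]
  refine Finset.sum_equiv Finsupp.equivFunOnFinite (fun t => ?_) (fun t _ => rfl)
  simp [Finset.Nat.mem_antidiagonalTuple, Finset.mem_finsuppAntidiag]

namespace CatalanProducts

open PowerSeries

/-- The generating function of the Catalan numbers, with integer coefficients. -/
noncomputable def catalanGF : ℤ⟦X⟧ := PowerSeries.map (Nat.castRingHom ℤ) catalanSeries

/-- The generating function of the central binomial coefficients. -/
noncomputable def centralBinomGF : ℤ⟦X⟧ := PowerSeries.mk fun n => (n.centralBinom : ℤ)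

theorem coeff_catalanGF (n : ℕ) : coeff n catalanGF = (catalan n : ℤ) := by
  simp [catalanGF]

theorem catalanGF_eq : catalanGF = X * catalanGF ^ 2 + 1 := by
  have h := congrArg (PowerSeries.map (Nat.castRingHom ℤ)) catalanSeries_sq_mul_X_add_one
  simp only [map_add, map_mul, map_pow, map_one, map_X] at h
  unfold catalanGF
  linear_combination -h

theorem derivative_X_mul_catalanGF : derivative ℤ (X * catalanGF) = centralBinomGF := by
  ext n
  rw [coeff_derivative, coeff_succ_X_mul, coeff_catalanGF, centralBinomGF, coeff_mk,
    ← succ_mul_catalan_eq_centralBinom]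
  push_cast
  ring

theorem centralBinomGF_mul : centralBinomGF * (1 - 2 * (X * catalanGF)) = 1 := by
  have h : (X * catalanGF) ^ 2 = X * catalanGF - X := by
    linear_combination -(X * catalanGF_eq)
  have h' := congrArg (derivative ℤ) h
  rw [derivative_pow, map_sub, derivative_X, derivative_X_mul_catalanGF] at h'
  norm_num at h'
  linear_combination -h'

theorem two_sub_catalanGF_mul :
    (2 - catalanGF) * (1 + X * (2 * centralBinomGF - catalanGF)) = 1 := by
  have h0 : (1 - 2 * (X * catalanGF) : ℤ⟦X⟧) ≠ 0 :=
    right_ne_zero_of_mul (centralBinomGF_mul ▸ one_ne_zero)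
  apply mul_right_cancel₀ h0
  linear_combination (2 - catalanGF) * 2 * X * centralBinomGF_mul
    - (2 * X * (2 - catalanGF) + 1) * catalanGF_eq

theorem coeff_geom_sum (n : ℕ) :
    coeff (n + 1) (∑ j ∈ Finset.range (n + 2), (X * catalanGF ^ 2) ^ j) =
      2 * (n.centralBinom : ℤ) - catalan n := by
  have h := mul_neg_geom_sum (X * catalanGF ^ 2) (n + 2)
  have hS : ∑ j ∈ Finset.range (n + 2), (X * catalanGF ^ 2) ^ j =
      1 + X * (2 * centralBinomGF - catalanGF) -
        X ^ (n + 2) * (catalanGF ^ (2 * (n + 2)) *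
          (1 + X * (2 * centralBinomGF - catalanGF))) := by
    rw [show 1 - X * catalanGF ^ 2 = 2 - catalanGF by linear_combination catalanGF_eq,
      mul_pow, ← pow_mul] at h
    linear_combination (1 + X * (2 * centralBinomGF - catalanGF)) * h
      - (∑ j ∈ Finset.range (n + 2), (X * catalanGF ^ 2) ^ j) * two_sub_catalanGF_mul
  rw [hS, map_sub, map_add, coeff_succ_X_mul, coeff_X_pow_mul', if_neg (by omega), coeff_one,
    if_neg (by omega), ← map_ofNat (C (R := ℤ)), map_sub, coeff_C_mul, coeff_catalanGF,
    centralBinomGF, coeff_mk]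
  ring

theorem sum_range_catalan_products (n : ℕ) :
    (∑ j ∈ Finset.range (n + 1), ∑ t ∈ Finset.Nat.antidiagonalTuple (2 * (j + 1)) (n - j),
      ∏ i, catalan (t i)) + catalan n = 2 * n.centralBinom := by
  have h := coeff_geom_sum n
  rw [Finset.sum_range_succ', map_add, map_sum, pow_zero, coeff_one, if_neg (by omega)] at h
  have hj : ∀ j ∈ Finset.range (n + 1), coeff (n + 1) ((X * catalanGF ^ 2) ^ (j + 1)) =
      ((∑ t ∈ Finset.Nat.antidiagonalTuple (2 * (j + 1)) (n - j),
        ∏ i, catalan (t i) : ℕ) : ℤ) := by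
    intro j hj
    rw [Finset.mem_range] at hj
    rw [mul_pow, ← pow_mul, coeff_X_pow_mul', if_pos (by omega), Nat.add_sub_add_right,
      coeff_pow_eq_sum_antidiagonalTuple]
    simp [coeff_catalanGF]
  rw [Finset.sum_congr rfl hj, ← Nat.cast_sum] at h
  omega

end CatalanProducts

/-- For odd `k ≥ 1`, the sum over even `m` with `2 ≤ m ≤ k + 1` of the sums over
`m`-tuples of naturals summing to `(k - m + 1) / 2` of products of Catalan numbers,
plus the Catalan number `C((k-1)/2)`, equals `2 * (k-1).choose ((k-1)/2)`. -/
theorem sum_catalan_products_odd (k : ℕ) (hk : 1 ≤ k) (hko : Odd k) :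
    (∑ m ∈ (Finset.Icc 2 (k + 1)).filter (fun m => Even m),
      ∑ t ∈ Finset.Nat.antidiagonalTuple m ((k + 1 - m) / 2),
        ∏ i, catalan (t i)) + catalan ((k - 1) / 2) =
    2 * (k - 1).choose ((k - 1) / 2) := by
  obtain ⟨n, rfl⟩ := hko
  rw [show (2 * n + 1 - 1) / 2 = n by omega, Nat.add_sub_cancel, ← Nat.centralBinom,
    ← CatalanProducts.sum_range_catalan_products]
  congr 1
  symm
  refine Finset.sum_nbij (fun j => 2 * (j + 1)) ?_ ?_ ?_ ?_
  · intro j hj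
    simp only [Finset.mem_range, Finset.mem_filter, Finset.mem_Icc] at hj ⊢
    exact ⟨by omega, even_two_mul _⟩
  · intro a _ b _ hab
    simp only at hab
    omega
  · intro m hm
    simp only [Finset.coe_filter, Finset.mem_Icc, Set.mem_ofPred_eq] at hm
    obtain ⟨hm, c, rfl⟩ := hm
    exact ⟨c - 1, by simp; omega, by simp only; omega⟩
  · intro j _
    rw [show (2 * n + 1 + 1 - 2 * (j + 1)) / 2 = n - j by omega]
end
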